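/- Let ε > 0 and α > 0. For every smooth compactly supported function u : ℝ² → ℝ whose support is contained in the closed ball of radius α centered at the origin, one has ∫_{ℝ²} u(x)² (ε²/(ε² + ‖x‖²))² dx ≤ (ε²/8) ∫_{ℝ²} ‖∇u(x)‖² dx + (1/(π ε²)) ( ∫_{ℝ²} u(x) (ε²/(ε² + ‖x‖²))² dx )². -/

import Mathlib

open MeasureTheory Real

lemma aux_cs (h : ℝ → ℝ) (hc : Continuous h) :
    (∫ t in (-π)..π, h t) ^ 2 / (2 * π) ≤ ∫ t in (-π)..π, h t ^ 2 := by
  set I := ∫ t in (-π)..π, h t with hI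
  have hp := Real.pi_pos
  have h0 : 0 ≤ ∫ t in (-π)..π, (h t - I / (2 * π)) ^ 2 :=
    intervalIntegral.integral_nonneg (by linarith) (fun t _ => sq_nonneg _)
  have h1 : ∫ t in (-π)..π, (h t - I / (2 * π)) ^ 2
      = (∫ t in (-π)..π, h t ^ 2) - 2 * (I / (2 * π)) * I + (I / (2 * π)) ^ 2 * (2 * π) := by
    have : ∀ t, (h t - I / (2 * π)) ^ 2
        = (h t ^ 2 - 2 * (I / (2 * π)) * h t) + (I / (2 * π)) ^ 2 := fun t => by ring
    simp_rw [this]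
    rw [intervalIntegral.integral_add, intervalIntegral.integral_sub,
      intervalIntegral.integral_const_mul, intervalIntegral.integral_const, ← hI]
    · simp only [smul_eq_mul]; ring
    all_goals exact Continuous.intervalIntegrable (by fun_prop) _ _
  rw [h1] at h0
  have : - (2 * (I / (2 * π)) * I) + (I / (2 * π)) ^ 2 * (2 * π) = - (I ^ 2 / (2 * π)) := by
    field_simp; ring
  linarith

lemma aux_wirt (f f' : ℝ → ℝ) (hf : ∀ x, HasDerivAt f (f' x) x) (hc : Continuous f')
    (hper : f (-π) = f π) :
    (∫ t in (-π)..π, f t ^ 2) - (∫ t in (-π)..π, f t) ^ 2 / (2 * π)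
      ≤ ∫ t in (-π)..π, f' t ^ 2 := by
  have hp := Real.pi_pos
  have hab : -π < π := by linarith
  have hfc : Continuous f := continuous_iff_continuousAt.2 fun x => (hf x).continuousAt
  have mem : ∀ g : ℝ → ℝ, Continuous g →
      MemLp (fun x => (g x : ℂ)) 2 (volume.restrict (Set.Ioc (-π) π)) := by
    intro g hg
    have hg' : Continuous (fun x => (g x : ℂ)) := Complex.continuous_ofReal.comp hg
    obtain ⟨C, hC⟩ := (isCompact_Icc (a := -π) (b := π)).exists_bound_of_continuousOn hg'.continuousOn
    refine MemLp.of_bound hg'.aestronglyMeasurable C ?_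
    filter_upwards [ae_restrict_mem measurableSet_Ioc] with x hx
    exact hC x ⟨hx.1.le, hx.2⟩
  have s1 := hasSum_sq_fourierCoeffOn hab (mem f hfc)
  have s2 := hasSum_sq_fourierCoeffOn hab (mem f' hc)
  set c := fourierCoeffOn hab (fun x => (f x : ℂ)) with hcdef
  set d := fourierCoeffOn hab (fun x => (f' x : ℂ)) with hddef
  have hn : ∀ n : ℤ, n ≠ 0 → ‖c n‖ ≤ ‖d n‖ := by
    intro n hn
    have := fourierCoeffOn_of_hasDerivAt hab (f := fun x => (f x : ℂ))
      (f' := fun x => (f' x : ℂ)) hn (fun x _ => (hf x).ofReal_comp)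
      ((Complex.continuous_ofReal.comp hc).intervalIntegrable _ _)
    rw [← hcdef, ← hddef, hper] at this
    have e : c n = d n / (Complex.I * n) := by
      rw [this]
      have hpc : (π : ℂ) ≠ 0 := by exact_mod_cast hp.ne'
      have hnc : (n : ℂ) ≠ 0 := by exact_mod_cast hn
      push_cast
      field_simp
      ring
    rw [e, norm_div, norm_mul, Complex.norm_I, one_mul]
    apply div_le_self (norm_nonneg _)
    rw [Complex.norm_intCast]
    exact_mod_cast Int.one_le_abs hn
  have h0 : c 0 = ((1 / (2 * π) * ∫ t in (-π)..π, f t : ℝ) : ℂ) := by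
    rw [hcdef, fourierCoeffOn_eq_integral]
    simp only [neg_zero, fourier_zero, one_smul]
    rw [intervalIntegral.integral_ofReal]
    simp only [Complex.real_smul]
    push_cast
    ring
  have s3 := s2.add (hasSum_ite_eq (0 : ℤ) (‖c 0‖ ^ 2))
  have key := hasSum_le (fun n => ?_) s1 s3
  · rw [h0, Complex.norm_real] at key
    simp only [Complex.norm_real, Real.norm_eq_abs, sq_abs, smul_eq_mul] at key
    have e : (π - -π) = 2 * π := by ring
    rw [e] at key
    have := mul_le_mul_of_nonneg_left key (by positivity : 0 ≤ 2 * π)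
    set X := ∫ t in (-π)..π, f t ^ 2
    set Y := ∫ t in (-π)..π, f' t ^ 2
    set I := ∫ t in (-π)..π, f t
    have a1 : 2 * π * ((2 * π)⁻¹ * X) = X := by field_simp
    have a2 : 2 * π * ((2 * π)⁻¹ * Y + (1 / (2 * π) * I) ^ 2) = Y + I ^ 2 / (2 * π) := by
      field_simp
    rw [a1, a2] at this
    linarith
  · by_cases h : n = 0
    · subst h; simp
    · simp only [h, if_false, add_zero]
      exact pow_le_pow_left₀ (norm_nonneg _) (hn n h) 2

lemma aux_T (ε : ℝ) (hε : 0 < ε) (r : ℝ) :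
    HasDerivAt (fun r : ℝ => (r ^ 2 - ε ^ 2) / (r ^ 2 + ε ^ 2))
      (4 * (ε ^ 2 * r / (r ^ 2 + ε ^ 2) ^ 2)) r := by
  have h : r ^ 2 + ε ^ 2 ≠ 0 := by positivity
  refine (((hasDerivAt_pow 2 r).sub_const (ε ^ 2)).div
    ((hasDerivAt_pow 2 r).add_const (ε ^ 2)) h).congr_deriv ?_
  push_cast
  field_simp
  ring

lemma aux_k (ε : ℝ) (hε : 0 < ε) :
    Continuous (fun r : ℝ => ε ^ 2 * r / (r ^ 2 + ε ^ 2) ^ 2) := by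
  apply Continuous.div (by fun_prop) (by fun_prop)
  intro r; positivity

lemma aux_angular (ε R : ℝ) (hε : 0 < ε) (hR : 0 < R) (A A' E : ℝ → ℝ)
    (hA : ∀ r, HasDerivAt A (A' r) r) (hA' : Continuous A') (hE : Continuous E)
    (hA0 : A 0 = 0) (hAR : A R = 0)
    (hineq : ∀ r, 0 < r → 0 ≤ E r + (r ^ 2 - ε ^ 2) / (r ^ 2 + ε ^ 2) * A' r
      - 4 * (ε ^ 2 * r / (r ^ 2 + ε ^ 2) ^ 2) * A r) :
    8 * ∫ r in (0:ℝ)..R, ε ^ 2 * r / (r ^ 2 + ε ^ 2) ^ 2 * A r ≤ ∫ r in (0:ℝ)..R, E r := by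
  have hk := aux_k ε hε
  have hAc : Continuous A := continuous_iff_continuousAt.2 fun x => (hA x).continuousAt
  have hT : Continuous (fun r : ℝ => (r ^ 2 - ε ^ 2) / (r ^ 2 + ε ^ 2)) :=
    continuous_iff_continuousAt.2 fun x => (aux_T ε hε x).continuousAt
  set k := fun r : ℝ => ε ^ 2 * r / (r ^ 2 + ε ^ 2) ^ 2 with hkd
  set T := fun r : ℝ => (r ^ 2 - ε ^ 2) / (r ^ 2 + ε ^ 2) with hTd
  have ftc : ∫ r in (0:ℝ)..R, (4 * k r * A r + T r * A' r) = T R * A R - T 0 * A 0 :=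
    intervalIntegral.integral_eq_sub_of_hasDerivAt (f := fun r => T r * A r)
      (fun r _ => (aux_T ε hε r).mul (hA r))
      (Continuous.intervalIntegrable (by fun_prop) _ _)
  rw [hA0, hAR] at ftc
  have h0 : 0 ≤ ∫ r in (0:ℝ)..R, (E r + T r * A' r - 4 * k r * A r) := by
    rw [intervalIntegral.integral_of_le hR.le]
    exact setIntegral_nonneg measurableSet_Ioc (fun r hr => hineq r hr.1)
  have e : ∀ r, (E r + T r * A' r - 4 * k r * A r)
      = E r + (4 * k r * A r + T r * A' r) - 8 * (k r * A r) := fun r => by ring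
  simp_rw [e] at h0
  rw [intervalIntegral.integral_sub, intervalIntegral.integral_add,
    intervalIntegral.integral_const_mul, ftc] at h0
  · simp only [hkd] at h0 ⊢
    linarith
  all_goals exact Continuous.intervalIntegrable (by fun_prop) _ _

lemma aux_radial (ε R : ℝ) (hε : 0 < ε) (hR : 0 < R) (f f' : ℝ → ℝ)
    (hf : ∀ r, HasDerivAt f (f' r) r) (hf' : Continuous f') (hfR : f R = 0) :
    8 * (∫ r in (0:ℝ)..R, ε ^ 2 * r / (r ^ 2 + ε ^ 2) ^ 2 * f r ^ 2)
      - 4 * (2 * ∫ r in (0:ℝ)..R, ε ^ 2 * r / (r ^ 2 + ε ^ 2) ^ 2 * f r) ^ 2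
      ≤ ∫ r in (0:ℝ)..R, r * f' r ^ 2 := by
  have hk := aux_k ε hε
  have hfc : Continuous f := continuous_iff_continuousAt.2 fun x => (hf x).continuousAt
  set k := fun r : ℝ => ε ^ 2 * r / (r ^ 2 + ε ^ 2) ^ 2 with hkd
  change 8 * (∫ r in (0:ℝ)..R, k r * f r ^ 2) - 4 * (2 * ∫ r in (0:ℝ)..R, k r * f r) ^ 2 ≤ _
  set m := 2 * ∫ r in (0:ℝ)..R, k r * f r with hm
  set F : ℝ → ℝ := fun r => ∫ s in (0:ℝ)..r, 4 * k s * (f s - m) with hF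
  set P : ℝ → ℝ := fun r => ∫ s in (0:ℝ)..r, (s * f' s ^ 2 - 8 * k s * (f s - m) ^ 2) with hP
  have dF : ∀ r, HasDerivAt F (4 * k r * (f r - m)) r := fun r =>
    intervalIntegral.integral_hasDerivAt_right
      (Continuous.intervalIntegrable (by fun_prop) _ _)
      (Continuous.stronglyMeasurableAtFilter (by fun_prop) _ _)
      (Continuous.continuousAt (by fun_prop))
  have dP : ∀ r, HasDerivAt P (r * f' r ^ 2 - 8 * k r * (f r - m) ^ 2) r := fun r =>
    intervalIntegral.integral_hasDerivAt_right
      (Continuous.intervalIntegrable (by fun_prop) _ _)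
      (Continuous.stronglyMeasurableAtFilter (by fun_prop) _ _)
      (Continuous.continuousAt (by fun_prop))
  have hF0 : F 0 = 0 := by simp [hF]
  have hP0 : P 0 = 0 := by simp [hP]
  have hFc : Continuous F := continuous_iff_continuousAt.2 fun x => (dF x).continuousAt
  have hPc : Continuous P := continuous_iff_continuousAt.2 fun x => (dP x).continuousAt
  set Φ : ℝ → ℝ := fun r => P r + 4 * (F r * (f r - m)) + (r ^ 4 - ε ^ 4) / ε ^ 2 * (F r / r) ^ 2
    with hΦ
  have dΦ : ∀ r, 0 < r → ∃ D, 0 ≤ D ∧ HasDerivAt Φ D r := by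
    intro r hr
    refine ⟨_, ?_, ((dP r).add (((dF r).mul ((hf r).sub_const m)).const_mul 4)).add
      ((((hasDerivAt_pow 4 r).sub_const (ε ^ 4)).div_const (ε ^ 2)).mul
        (((dF r).div (hasDerivAt_id r) hr.ne').pow 2))⟩
    have : 0 ≤ r * (f' r + 2 * F r / r) ^ 2 +
        8 * k r * ((f r - m) + (r ^ 4 - ε ^ 4) / (2 * ε ^ 2 * r ^ 2) * F r) ^ 2 := by
      have : 0 ≤ k r := by simp only [hkd]; positivity
      positivity
    refine this.trans_eq ?_
    simp only [hkd, Pi.div_apply, id, Nat.add_one_sub_one, pow_one]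
    push_cast
    have : r ^ 2 + ε ^ 2 ≠ 0 := by positivity
    field_simp
    ring
  have hslope : ContinuousAt (fun r => F r / r) 0 := by
    have h := hasDerivAt_iff_tendsto_slope.1 (dF 0)
    rw [continuousAt_iff_punctured_nhds]
    have e : 4 * k 0 * (f 0 - m) = F 0 / 0 := by simp [hkd]
    rw [e] at h
    refine h.congr fun r => ?_
    rw [slope_def_field, hF0, sub_zero, sub_zero]
  have mono : MonotoneOn Φ (Set.Icc 0 R) := by
    apply monotoneOn_of_deriv_nonneg (convex_Icc 0 R)
    · intro r hr
      apply ContinuousAt.continuousWithinAt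
      rcases hr.1.eq_or_lt with h | h
      · subst h
        simp only [hΦ]
        have : ContinuousAt (fun r => (F r / r) ^ 2) 0 := hslope.pow 2
        fun_prop
      · obtain ⟨D, _, hD⟩ := dΦ r h
        exact hD.continuousAt
    · intro r hr
      rw [interior_Icc] at hr
      obtain ⟨D, _, hD⟩ := dΦ r hr.1
      exact hD.differentiableAt.differentiableWithinAt
    · intro r hr
      rw [interior_Icc] at hr
      obtain ⟨D, h0, hD⟩ := dΦ r hr.1
      rwa [hD.deriv]
  have key := mono ⟨le_rfl, hR.le⟩ ⟨hR.le, le_rfl⟩ hR.le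
  have hΦ0 : Φ 0 = 0 := by simp [hΦ, hF0, hP0]
  have ik : ∫ s in (0:ℝ)..R, 4 * k s = 2 * R ^ 2 / (R ^ 2 + ε ^ 2) := by
    rw [intervalIntegral.integral_eq_sub_of_hasDerivAt (fun r _ => aux_T ε hε r)
      (Continuous.intervalIntegrable (continuous_const.mul hk) _ _)]
    field_simp
    ring
  have hFR : F R = m * (2 * ε ^ 2 / (R ^ 2 + ε ^ 2)) := by
    simp only [hF]
    have : ∀ s, 4 * k s * (f s - m) = 4 * (k s * f s) - m * (4 * k s) := fun s => by ring
    simp_rw [this]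
    rw [intervalIntegral.integral_sub, intervalIntegral.integral_const_mul,
      intervalIntegral.integral_const_mul, ik]
    · rw [show ∫ r in (0:ℝ)..R, k r * f r = m / 2 by rw [hm]; ring]
      field_simp
      ring
    all_goals exact Continuous.intervalIntegrable (by fun_prop) _ _
  have hPR : P R = (∫ r in (0:ℝ)..R, r * f' r ^ 2) - 8 * (∫ r in (0:ℝ)..R, k r * f r ^ 2)
      + 8 * m ^ 2 - 2 * m ^ 2 * (2 * R ^ 2 / (R ^ 2 + ε ^ 2)) := by
    simp only [hP]
    have : ∀ s, s * f' s ^ 2 - 8 * k s * (f s - m) ^ 2 = s * f' s ^ 2 - 8 * (k s * f s ^ 2)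
      + (16 * m) * (k s * f s) - (2 * m ^ 2) * (4 * k s) := fun s => by ring
    simp_rw [this]
    rw [intervalIntegral.integral_sub, intervalIntegral.integral_add,
      intervalIntegral.integral_sub, intervalIntegral.integral_const_mul,
      intervalIntegral.integral_const_mul, intervalIntegral.integral_const_mul, ik]
    · rw [show ∫ r in (0:ℝ)..R, k r * f r = m / 2 by rw [hm]; ring]
      ring
    all_goals exact Continuous.intervalIntegrable (by fun_prop) _ _
  rw [hΦ0] at key
  simp only [hΦ, hPR, hFR, hfR] at key
  set X := ∫ r in (0:ℝ)..R, r * f' r ^ 2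
  set Y := ∫ r in (0:ℝ)..R, k r * f r ^ 2
  have : X - 8 * Y + 4 * m ^ 2 = (X - 8 * Y + 8 * m ^ 2 - 2 * m ^ 2 * (2 * R ^ 2 / (R ^ 2 + ε ^ 2)) +
        4 * (m * (2 * ε ^ 2 / (R ^ 2 + ε ^ 2)) * (0 - m)) +
      (R ^ 4 - ε ^ 4) / ε ^ 2 * (m * (2 * ε ^ 2 / (R ^ 2 + ε ^ 2)) / R) ^ 2)
      + 4 * m ^ 2 * ε ^ 4 / (R ^ 2 * (R ^ 2 + ε ^ 2)) := by
    field_simp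
    ring
  have h2 : 0 ≤ 4 * m ^ 2 * ε ^ 4 / (R ^ 2 * (R ^ 2 + ε ^ 2)) := by positivity
  linarith

lemma aux_param (g g' : ℝ → ℝ → ℝ) (hg : Continuous (fun p : ℝ × ℝ => g p.1 p.2))
    (hg' : Continuous (fun p : ℝ × ℝ => g' p.1 p.2))
    (hd : ∀ r t, HasDerivAt (fun r => g r t) (g' r t) r) (r : ℝ) :
    HasDerivAt (fun r => ∫ t in (-π)..π, g r t) (∫ t in (-π)..π, g' r t) r := by
  obtain ⟨C, hC⟩ := ((isCompact_closedBall r 1).prod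
    (isCompact_uIcc (a := -π) (b := π))).exists_bound_of_continuousOn hg'.continuousOn
  have c1 : ∀ r, Continuous (g r) := fun r => hg.comp (by fun_prop : Continuous fun t => (r, t))
  have c2 : ∀ r, Continuous (g' r) := fun r => hg'.comp (by fun_prop : Continuous fun t => (r, t))
  refine (intervalIntegral.hasDerivAt_integral_of_dominated_loc_of_deriv_le
    (bound := fun _ => C) (F := g) (F' := g') (Metric.closedBall_mem_nhds r one_pos) ?_
    ((c1 r).intervalIntegrable _ _) (c2 r).aestronglyMeasurable ?_ (by simp) ?_).2
  · exact Filter.Eventually.of_forall fun r => (c1 r).aestronglyMeasurable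
  · exact Filter.Eventually.of_forall fun t ht x hx =>
      hC (x, t) ⟨hx, Set.uIoc_subset_uIcc ht⟩
  · exact Filter.Eventually.of_forall fun t ht x hx => hd x t

lemma aux_cont (g : ℝ → ℝ → ℝ) (hg : Continuous (fun p : ℝ × ℝ => g p.1 p.2)) :
    Continuous (fun r => ∫ t in (-π)..π, g r t) :=
  intervalIntegral.continuous_parametric_intervalIntegral_of_continuous' hg _ _

noncomputable def auxPt (r t : ℝ) : EuclideanSpace ℝ (Fin 2) := !₂[r * cos t, r * sin t]

lemma auxPt_cont : Continuous (fun p : ℝ × ℝ => auxPt p.1 p.2) := by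
  unfold auxPt
  fun_prop

lemma auxPt_norm (r t : ℝ) : ‖auxPt r t‖ ^ 2 = r ^ 2 := by
  rw [EuclideanSpace.norm_sq_eq]
  simp [auxPt, Fin.sum_univ_two]
  linear_combination r ^ 2 * Real.cos_sq_add_sin_sq t

lemma aux_polar (R : ℝ) (hR : 0 < R) (F : EuclideanSpace ℝ (Fin 2) → ℝ) (hF : Continuous F)
    (h0 : ∀ x, R ≤ ‖x‖ → F x = 0) :
    ∫ x, F x = ∫ r in (0:ℝ)..R, ∫ t in (-π)..π, r * F (auxPt r t) := by
  have hp := Real.pi_pos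
  have e1 : ∫ x, F x = ∫ p : ℝ × ℝ, F !₂[p.1, p.2] := by
    rw [← (PiLp.volume_preserving_toLp (Fin 2)).integral_comp
      (MeasurableEquiv.toLp 2 (Fin 2 → ℝ)).measurableEmbedding,
      ← (volume_preserving_finTwoArrow ℝ).symm.integral_comp
      (MeasurableEquiv.finTwoArrow (α := ℝ)).symm.measurableEmbedding]
    rfl
  rw [e1, ← integral_comp_polarCoord_symm]
  have e2 : polarCoord.target = Set.Ioi (0:ℝ) ×ˢ Set.Ioo (-π) π := rfl
  have e3 : ∀ p : ℝ × ℝ, p.1 • F !₂[(polarCoord.symm p).1, (polarCoord.symm p).2]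
      = p.1 * F (auxPt p.1 p.2) := fun p => rfl
  simp_rw [e3]
  rw [e2, setIntegral_eq_of_subset_of_forall_sdiff_eq_zero
    (s := Set.Ioc (0:ℝ) R ×ˢ Set.Ioo (-π) π)
    (measurableSet_Ioi.prod measurableSet_Ioo)
    (Set.prod_mono Set.Ioc_subset_Ioi_self subset_rfl), Measure.volume_eq_prod, setIntegral_prod]
  · rw [intervalIntegral.integral_of_le hR.le]
    refine setIntegral_congr_fun measurableSet_Ioc fun r hr => ?_
    simp only
    rw [intervalIntegral.integral_of_le (by linarith), integral_Ioc_eq_integral_Ioo]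
  · have : Continuous fun p : ℝ × ℝ => p.1 * F (auxPt p.1 p.2) :=
      continuous_fst.mul (hF.comp auxPt_cont)
    exact (this.continuousOn.integrableOn_compact
      ((isCompact_Icc (a := (0:ℝ)) (b := R)).prod (isCompact_Icc (a := -π) (b := π)))).mono_set
      (Set.prod_mono Set.Ioc_subset_Icc_self Set.Ioo_subset_Icc_self)
  · rintro ⟨r, t⟩ ⟨⟨hr, ht⟩, hn⟩
    have hrR : R < r := by
      by_contra h
      exact hn ⟨⟨hr, not_lt.1 h⟩, ht⟩
    have : ‖auxPt r t‖ = r := by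
      have h := auxPt_norm r t
      exact (pow_left_inj₀ (norm_nonneg _) (le_of_lt hr) two_ne_zero).1 h
    simp only
    rw [h0 _ (by rw [this]; exact hrR.le), mul_zero]

lemma aux_dr (r t : ℝ) : HasDerivAt (fun r => auxPt r t) (auxPt 1 t) r := by
  have : (fun r => auxPt r t) = fun r => r • auxPt 1 t := by
    funext r; ext i; fin_cases i <;> simp [auxPt]
  rw [this]
  simpa using (hasDerivAt_id r).smul_const (auxPt 1 t)

noncomputable def auxPn (t : ℝ) : EuclideanSpace ℝ (Fin 2) := !₂[-sin t, cos t]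

lemma auxPn_cont : Continuous auxPn := by
  unfold auxPn
  fun_prop

lemma aux_dt (r t : ℝ) : HasDerivAt (fun t => auxPt r t) (r • auxPn t) t := by
  have h : HasDerivAt (fun t => (![r * cos t, r * sin t] : Fin 2 → ℝ))
      ((![r * -sin t, r * cos t] : Fin 2 → ℝ)) t := by
    rw [hasDerivAt_pi]
    intro i
    fin_cases i
    · simpa using (hasDerivAt_cos t).const_mul r
    · simpa using (hasDerivAt_sin t).const_mul r
  have := (PiLp.continuousLinearEquiv 2 ℝ (fun _ : Fin 2 => ℝ)).symm.hasFDerivAt.comp_hasDerivAt t h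
  convert! this using 1
  ext i; fin_cases i <;> simp [auxPn]

lemma aux_grad (u : EuclideanSpace ℝ (Fin 2) → ℝ) (x : EuclideanSpace ℝ (Fin 2)) (t : ℝ) :
    ‖gradient u x‖ ^ 2 = (fderiv ℝ u x (auxPt 1 t)) ^ 2 + (fderiv ℝ u x (auxPn t)) ^ 2 := by
  rw [← inner_gradient_left, ← inner_gradient_left, EuclideanSpace.norm_sq_eq,
    PiLp.inner_apply, PiLp.inner_apply]
  simp [auxPt, auxPn, Fin.sum_univ_two]
  linear_combination (-(gradient u x).ofLp 0 ^ 2 - (gradient u x).ofLp 1 ^ 2) * Real.cos_sq_add_sin_sq t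

theorem stmt_0 (ε α : ℝ) (hε : 0 < ε) (hα : 0 < α)
    (u : EuclideanSpace ℝ (Fin 2) → ℝ) (hu : ContDiff ℝ (⊤ : ℕ∞) u)
    (hu_supp : HasCompactSupport u)
    (hsupp : tsupport u ⊆ Metric.closedBall 0 α) :
    ∫ x : EuclideanSpace ℝ (Fin 2), (u x) ^ 2 * (ε ^ 2 / (ε ^ 2 + ‖x‖ ^ 2)) ^ 2 ≤
      (ε ^ 2 / 8) * (∫ x : EuclideanSpace ℝ (Fin 2), ‖gradient u x‖ ^ 2) +
        (1 / (π * ε ^ 2)) *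
          (∫ x : EuclideanSpace ℝ (Fin 2), u x * (ε ^ 2 / (ε ^ 2 + ‖x‖ ^ 2)) ^ 2) ^ 2 := by
  have hp := Real.pi_pos
  set R := α + 1 with hRd
  have hR : 0 < R := by linarith
  have hnot : ∀ x : EuclideanSpace ℝ (Fin 2), R ≤ ‖x‖ → x ∉ tsupport u := by
    intro x hx hmem
    have := hsupp hmem
    rw [mem_closedBall_zero_iff] at this
    linarith
  have hu0 : ∀ x, R ≤ ‖x‖ → u x = 0 := fun x hx => image_eq_zero_of_notMem_tsupport (hnot x hx)
  have hfd0 : ∀ x, R ≤ ‖x‖ → fderiv ℝ u x = 0 := fun x hx =>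
    fderiv_of_notMem_tsupport ℝ (hnot x hx)
  have hdiff : Differentiable ℝ u := hu.differentiable (by simp)
  have huc : Continuous u := hdiff.continuous
  have hfdc : Continuous (fderiv ℝ u) := hu.continuous_fderiv (by simp)
  have hgc : Continuous (fun x => ‖gradient u x‖ ^ 2) := by
    have : (fun x => ‖gradient u x‖ ^ 2) = fun x =>
        (fderiv ℝ u x (auxPt 1 0)) ^ 2 + (fderiv ℝ u x (auxPn 0)) ^ 2 := by
      funext x; exact aux_grad u x 0
    rw [this]; fun_prop
  have hwc : Continuous (fun x : EuclideanSpace ℝ (Fin 2) => (ε ^ 2 / (ε ^ 2 + ‖x‖ ^ 2)) ^ 2) := by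
    refine (Continuous.div (by fun_prop) (by fun_prop) ?_).pow 2
    intro x; positivity
  rw [aux_polar R hR (fun x => (u x) ^ 2 * (ε ^ 2 / (ε ^ 2 + ‖x‖ ^ 2)) ^ 2) ((huc.pow 2).mul hwc) (fun x hx => by simp [hu0 x hx]),
    aux_polar R hR _ hgc (fun x hx => by rw [aux_grad u x 0, hfd0 x hx]; simp),
    aux_polar R hR (fun x => u x * (ε ^ 2 / (ε ^ 2 + ‖x‖ ^ 2)) ^ 2) (huc.mul hwc) (fun x hx => by simp [hu0 x hx])]
  set G : ℝ → ℝ → ℝ := fun r t => u (auxPt r t) with hG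
  set H : ℝ → ℝ → ℝ := fun r t => fderiv ℝ u (auxPt r t) (auxPt 1 t) with hH
  set K : ℝ → ℝ → ℝ := fun r t => fderiv ℝ u (auxPt r t) (auxPn t) with hK
  have hpt := auxPt_cont
  have hpt1 : Continuous (fun p : ℝ × ℝ => auxPt 1 p.2) :=
    hpt.comp (by fun_prop : Continuous fun p : ℝ × ℝ => ((1:ℝ), p.2))
  have hpn : Continuous (fun p : ℝ × ℝ => auxPn p.2) := auxPn_cont.comp continuous_snd
  have cG : Continuous (fun p : ℝ × ℝ => G p.1 p.2) := huc.comp hpt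
  have cH : Continuous (fun p : ℝ × ℝ => H p.1 p.2) := (hfdc.comp hpt).clm_apply hpt1
  have cK : Continuous (fun p : ℝ × ℝ => K p.1 p.2) := (hfdc.comp hpt).clm_apply hpn
  have cG1 : ∀ r, Continuous (G r) := fun r => cG.comp (by fun_prop : Continuous fun t => (r, t))
  have cH1 : ∀ r, Continuous (H r) := fun r => cH.comp (by fun_prop : Continuous fun t => (r, t))
  have cK1 : ∀ r, Continuous (K r) := fun r => cK.comp (by fun_prop : Continuous fun t => (r, t))
  have dG : ∀ r t, HasDerivAt (fun r => G r t) (H r t) r := fun r t =>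
    (hdiff (auxPt r t)).hasFDerivAt.comp_hasDerivAt r (aux_dr r t)
  have dGt : ∀ r t, HasDerivAt (fun t => G r t) (r * K r t) t := fun r t => by
    have := (hdiff (auxPt r t)).hasFDerivAt.comp_hasDerivAt t (aux_dt r t)
    simpa [hK, hG] using! this
  have dG2 : ∀ r t, HasDerivAt (fun r => G r t ^ 2) (2 * (G r t * H r t)) r := fun r t => by
    refine ((dG r t).pow 2).congr_deriv ?_
    push_cast; ring
  -- angular integrals
  set Q : ℝ → ℝ := fun r => ∫ t in (-π)..π, G r t with hQ
  set Q' : ℝ → ℝ := fun r => ∫ t in (-π)..π, H r t with hQ'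
  set P : ℝ → ℝ := fun r => ∫ t in (-π)..π, G r t ^ 2 with hP
  set M : ℝ → ℝ := fun r => ∫ t in (-π)..π, G r t * H r t with hM
  set S : ℝ → ℝ := fun r => ∫ t in (-π)..π, H r t ^ 2 with hS
  set L : ℝ → ℝ := fun r => ∫ t in (-π)..π, K r t ^ 2 with hL
  have dQ : ∀ r, HasDerivAt Q (Q' r) r := aux_param G H cG cH dG
  have dP : ∀ r, HasDerivAt P (2 * M r) r := fun r => by
    have := aux_param (fun r t => G r t ^ 2) (fun r t => 2 * (G r t * H r t)) (by fun_prop)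
      (by fun_prop) dG2 r
    rwa [intervalIntegral.integral_const_mul] at this
  have cQ' : Continuous Q' := aux_cont H cH
  have cM : Continuous M := aux_cont (fun r t => G r t * H r t) (by fun_prop)
  have cS : Continuous S := aux_cont (fun r t => H r t ^ 2) (by fun_prop)
  have cL : Continuous L := aux_cont (fun r t => K r t ^ 2) (by fun_prop)
  have cQ : Continuous Q := continuous_iff_continuousAt.2 fun x => (dQ x).continuousAt
  have cP : Continuous P := continuous_iff_continuousAt.2 fun x => (dP x).continuousAt
  have hGR : ∀ t, G R t = 0 := fun t => by
    apply hu0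
    have := auxPt_norm R t
    rw [(pow_left_inj₀ (norm_nonneg _) hR.le two_ne_zero).1 this]
  have hG0 : ∀ t, G 0 t = u 0 := fun t => by
    simp only [hG]; congr 1; ext i; fin_cases i <;> simp [auxPt]
  have hper : ∀ r, G r (-π) = G r π := fun r => by simp [hG, auxPt]
  have wirt : ∀ r, P r - Q r ^ 2 / (2 * π) ≤ r ^ 2 * L r := fun r => by
    have := aux_wirt (G r) (fun t => r * K r t) (dGt r) (continuous_const.mul (cK1 r)) (hper r)
    simp_rw [mul_pow] at this
    rwa [intervalIntegral.integral_const_mul] at this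
  have cs : ∀ r T : ℝ, (r * Q' r + T * Q r) ^ 2 / (2 * π)
      ≤ r ^ 2 * S r + 2 * r * T * M r + T ^ 2 * P r := fun r T => by
    have c1 := cG1 r
    have c2 := cH1 r
    have := aux_cs (fun t => r * H r t + T * G r t) (by fun_prop)
    have e : ∀ t, (r * H r t + T * G r t) ^ 2
      = r ^ 2 * H r t ^ 2 + 2 * r * T * (G r t * H r t) + T ^ 2 * G r t ^ 2 := fun t => by ring
    simp_rw [e] at this
    rw [intervalIntegral.integral_add, intervalIntegral.integral_add,
      intervalIntegral.integral_add, intervalIntegral.integral_const_mul,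
      intervalIntegral.integral_const_mul, intervalIntegral.integral_const_mul,
      intervalIntegral.integral_const_mul, intervalIntegral.integral_const_mul] at this
    · exact this
    all_goals exact Continuous.intervalIntegrable (by fun_prop) _ _
  -- angular part
  have ang := aux_angular ε R hε hR (fun r => P r - Q r ^ 2 / (2 * π))
    (fun r => 2 * M r - 2 * Q r * Q' r / (2 * π))
    (fun r => r * (S r - Q' r ^ 2 / (2 * π)) + r * L r)
    (fun r => by
      refine ((dP r).sub (((dQ r).pow 2).div_const (2 * π))).congr_deriv ?_
      push_cast; ring)
    (by fun_prop) (by fun_prop)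
    (by
      simp only [hP, hQ, hG0, intervalIntegral.integral_const, smul_eq_mul]
      field_simp; ring)
    (by simp [hP, hQ, hGR])
    (fun r hr => by
      set T := (r ^ 2 - ε ^ 2) / (r ^ 2 + ε ^ 2) with hT
      have h1 := cs r T
      have h2 := wirt r
      have hk : 4 * (ε ^ 2 * r / (r ^ 2 + ε ^ 2) ^ 2) = (1 - T ^ 2) / r := by
        rw [hT]; field_simp; ring
      rw [hk]
      have e : r * (S r - Q' r ^ 2 / (2 * π)) + r * L r + T * (2 * M r - 2 * Q r * Q' r / (2 * π))
          - (1 - T ^ 2) / r * (P r - Q r ^ 2 / (2 * π))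
          = ((r ^ 2 * S r + 2 * r * T * M r + T ^ 2 * P r - (r * Q' r + T * Q r) ^ 2 / (2 * π))
            + (r ^ 2 * L r - (P r - Q r ^ 2 / (2 * π)))) / r := by
        field_simp; ring
      rw [e]
      apply div_nonneg _ hr.le
      linarith)
  have rad := aux_radial ε R hε hR (fun r => Q r / (2 * π)) (fun r => Q' r / (2 * π))
    (fun r => (dQ r).div_const _) (by fun_prop) (by simp [hQ, hGR])
  -- rewrite the three integrals
  have hk := aux_k ε hε
  set k := fun r : ℝ => ε ^ 2 * r / (r ^ 2 + ε ^ 2) ^ 2 with hkd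
  have kw : ∀ r t : ℝ, r * (ε ^ 2 / (ε ^ 2 + ‖auxPt r t‖ ^ 2)) ^ 2 = ε ^ 2 * k r := fun r t => by
    rw [auxPt_norm, hkd]; simp only
    rw [add_comm (r ^ 2)]
    have : ε ^ 2 + r ^ 2 ≠ 0 := by positivity
    field_simp
  have i1 : ∀ r, ∫ t in (-π)..π, r * (u (auxPt r t) ^ 2 * (ε ^ 2 / (ε ^ 2 + ‖auxPt r t‖ ^ 2)) ^ 2)
      = ε ^ 2 * (k r * P r) := fun r => by
    have : ∀ t, r * (u (auxPt r t) ^ 2 * (ε ^ 2 / (ε ^ 2 + ‖auxPt r t‖ ^ 2)) ^ 2)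
        = (ε ^ 2 * k r) * G r t ^ 2 := fun t => by rw [← kw r t]; ring
    simp_rw [this]
    rw [intervalIntegral.integral_const_mul, mul_assoc]
  have i2 : ∀ r, ∫ t in (-π)..π, r * (u (auxPt r t) * (ε ^ 2 / (ε ^ 2 + ‖auxPt r t‖ ^ 2)) ^ 2)
      = ε ^ 2 * (k r * Q r) := fun r => by
    have : ∀ t, r * (u (auxPt r t) * (ε ^ 2 / (ε ^ 2 + ‖auxPt r t‖ ^ 2)) ^ 2)
        = (ε ^ 2 * k r) * G r t := fun t => by rw [← kw r t]; ring
    simp_rw [this]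
    rw [intervalIntegral.integral_const_mul, mul_assoc]
  have i3 : ∀ r, ∫ t in (-π)..π, r * ‖gradient u (auxPt r t)‖ ^ 2 = r * (S r + L r) := fun r => by
    have : ∀ t, ‖gradient u (auxPt r t)‖ ^ 2 = H r t ^ 2 + K r t ^ 2 :=
      fun t => aux_grad u (auxPt r t) t
    simp_rw [this]
    have c1 := cH1 r
    have c2 := cK1 r
    rw [intervalIntegral.integral_const_mul, intervalIntegral.integral_add]
    all_goals exact Continuous.intervalIntegrable (by fun_prop) _ _
  simp_rw [i1, i2, i3]
  rw [intervalIntegral.integral_const_mul, intervalIntegral.integral_const_mul]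
  change 8 * (∫ r in (0:ℝ)..R, k r * (P r - Q r ^ 2 / (2 * π))) ≤ _ at ang
  change 8 * (∫ r in (0:ℝ)..R, k r * (Q r / (2 * π)) ^ 2)
    - 4 * (2 * ∫ r in (0:ℝ)..R, k r * (Q r / (2 * π))) ^ 2 ≤ _ at rad
  have j1 : ∫ r in (0:ℝ)..R, k r * (P r - Q r ^ 2 / (2 * π))
      = (∫ r in (0:ℝ)..R, k r * P r) - (1 / (2 * π)) * ∫ r in (0:ℝ)..R, k r * Q r ^ 2 := by
    rw [← intervalIntegral.integral_const_mul, ← intervalIntegral.integral_sub]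
    · congr 1; funext r; ring
    all_goals exact Continuous.intervalIntegrable (by fun_prop) _ _
  have j2 : ∫ r in (0:ℝ)..R, (r * (S r - Q' r ^ 2 / (2 * π)) + r * L r)
      = (∫ r in (0:ℝ)..R, r * (S r + L r)) - (1 / (2 * π)) * ∫ r in (0:ℝ)..R, r * Q' r ^ 2 := by
    rw [← intervalIntegral.integral_const_mul, ← intervalIntegral.integral_sub]
    · congr 1; funext r; ring
    all_goals exact Continuous.intervalIntegrable (by fun_prop) _ _
  have j3 : ∫ r in (0:ℝ)..R, k r * (Q r / (2 * π)) ^ 2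
      = (1 / (2 * π)) ^ 2 * ∫ r in (0:ℝ)..R, k r * Q r ^ 2 := by
    rw [← intervalIntegral.integral_const_mul]
    congr 1; funext r; ring
  have j4 : ∫ r in (0:ℝ)..R, k r * (Q r / (2 * π))
      = (1 / (2 * π)) * ∫ r in (0:ℝ)..R, k r * Q r := by
    rw [← intervalIntegral.integral_const_mul]
    congr 1; funext r; ring
  have j5 : ∫ r in (0:ℝ)..R, r * (Q' r / (2 * π)) ^ 2
      = (1 / (2 * π)) ^ 2 * ∫ r in (0:ℝ)..R, r * Q' r ^ 2 := by
    rw [← intervalIntegral.integral_const_mul]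
    congr 1; funext r; ring
  rw [j1, j2] at ang
  rw [j3, j4, j5] at rad
  set a := ∫ r in (0:ℝ)..R, k r * P r
  set b := ∫ r in (0:ℝ)..R, k r * Q r ^ 2
  set c := ∫ r in (0:ℝ)..R, k r * Q r
  set d := ∫ r in (0:ℝ)..R, r * Q' r ^ 2
  set e := ∫ r in (0:ℝ)..R, r * (S r + L r)
  have rad' := mul_le_mul_of_nonneg_left rad (by positivity : 0 ≤ 2 * π)
  have r1 : 2 * π * (8 * ((1 / (2 * π)) ^ 2 * b) - 4 * (2 * (1 / (2 * π) * c)) ^ 2)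
      = 8 * (1 / (2 * π) * b) - 8 * (c ^ 2 / π) := by field_simp; ring
  have r2 : 2 * π * ((1 / (2 * π)) ^ 2 * d) = 1 / (2 * π) * d := by field_simp
  rw [r1, r2] at rad'
  have fin : a ≤ e / 8 + c ^ 2 / π := by linarith
  have := mul_le_mul_of_nonneg_left fin (by positivity : 0 ≤ ε ^ 2)
  refine this.trans_eq ?_
  field_simp
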